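/- Let N ≥ 3, α > 0, and let 1 ≤ σ < 4/(N−2). Then there exists an exponent r with 2 < r ≤ 2N/(N−2) and a constant C_α > 0, depending only on N, σ, α, such that: for every Schwartz function v : ℝ^N → ℂ and every Schwartz function w : ℝ^N → ℝ satisfying w − α²Δw = |v|^σ pointwise on ℝ^N, and for all Schwartz functions v₁, v₂ : ℝ^N → ℂ, one has ‖w · |v|^{σ−1} v · (v₁ − v₂)‖_{L^{r'}} ≤ C_α ‖v‖_{H¹}^{2σ} ‖v₁ − v₂‖_{L^r}, where 1/r + 1/r' = 1. -/

import Mathlib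

open MeasureTheory Real Set
open scoped ENNReal NNReal ComplexConjugate

noncomputable section

/-- Standard basis vector of `ℝ^N`. -/
def basisVec (N : ℕ) (i : Fin N) : EuclideanSpace ℝ (Fin N) :=
  EuclideanSpace.single i 1

/-- The Laplacian of a function on `ℝ^N`. -/
def lap {E : Type*} [NormedAddCommGroup E] [NormedSpace ℝ E]
    (N : ℕ) (u : EuclideanSpace ℝ (Fin N) → E) (x : EuclideanSpace ℝ (Fin N)) : E :=
  ∑ i : Fin N, fderiv ℝ (fun y => fderiv ℝ u y (basisVec N i)) x (basisVec N i)

/-- The `L^p` norm (with real exponent `p`) of a function on `ℝ^N`. -/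
def LpN (N : ℕ) {E : Type*} [NormedAddCommGroup E]
    (f : EuclideanSpace ℝ (Fin N) → E) (p : ℝ) : ℝ :=
  (eLpNorm f (ENNReal.ofReal p) volume).toReal

/-- The `L²` norm of the (total) derivative of a function on `ℝ^N`. -/
def gradL2 (N : ℕ) (v : EuclideanSpace ℝ (Fin N) → ℂ) : ℝ :=
  (eLpNorm (fun x => fderiv ℝ v x) 2 volume).toReal

/-- The `H¹` norm of a function on `ℝ^N`. -/
def H1norm (N : ℕ) (v : EuclideanSpace ℝ (Fin N) → ℂ) : ℝ :=
  Real.sqrt ((LpN N v 2) ^ 2 + (gradL2 N v) ^ 2)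

theorem eLpNorm_le_of_le_of_le {α F : Type*} [MeasurableSpace α] {μ : Measure α}
    [NormedAddCommGroup F] {f : α → F} (hf : AEStronglyMeasurable f μ) {p k q : ℝ}
    (hp : 0 < p) (hpk : p ≤ k) (hkq : k ≤ q) {A : ℝ≥0∞}
    (hfp : eLpNorm f (ENNReal.ofReal p) μ ≤ A) (hfq : eLpNorm f (ENNReal.ofReal q) μ ≤ A) :
    eLpNorm f (ENNReal.ofReal k) μ ≤ A := by
  have key : ∀ s : ℝ, 0 < s →
      (eLpNorm f (ENNReal.ofReal s) μ ≤ A ↔ ∫⁻ x, ‖f x‖ₑ ^ s ∂μ ≤ A ^ s) := by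
    intro s hs
    rw [eLpNorm_eq_lintegral_rpow_enorm_toReal (by simpa using hs) ENNReal.ofReal_ne_top,
      ENNReal.toReal_ofReal hs.le, one_div, ENNReal.rpow_inv_le_iff hs]
  have hk : 0 < k := hp.trans_le hpk
  rw [key _ hp] at hfp
  rw [key _ (hk.trans_le hkq)] at hfq
  rw [key _ hk]
  obtain ⟨a, b, ha, hb, hab, rfl⟩ : k ∈ segment ℝ p q := by
    rw [segment_eq_Icc (hpk.trans hkq)]; exact ⟨hpk, hkq⟩
  simp only [smul_eq_mul] at *
  calc ∫⁻ x, ‖f x‖ₑ ^ (a * p + b * q) ∂μ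
      = ∫⁻ x, (‖f x‖ₑ ^ p) ^ a * (‖f x‖ₑ ^ q) ^ b ∂μ := by
        refine lintegral_congr fun x => ?_
        rw [← ENNReal.rpow_mul, ← ENNReal.rpow_mul, mul_comm p, mul_comm q]
        exact ENNReal.rpow_add_of_nonneg _ _ (by positivity)
          (mul_nonneg hb (hp.le.trans (hpk.trans hkq)))
    _ ≤ (∫⁻ x, ‖f x‖ₑ ^ p ∂μ) ^ a * (∫⁻ x, ‖f x‖ₑ ^ q ∂μ) ^ b :=
        ENNReal.lintegral_mul_norm_pow_le (hf.enorm.pow_const _) (hf.enorm.pow_const _) ha hb hab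
    _ ≤ (A ^ p) ^ a * (A ^ q) ^ b := by gcongr
    _ = A ^ (a * p + b * q) := by
        rw [← ENNReal.rpow_mul, ← ENNReal.rpow_mul, mul_comm p, mul_comm q]
        exact (ENNReal.rpow_add_of_nonneg _ _ (by positivity)
          (mul_nonneg hb (hp.le.trans (hpk.trans hkq)))).symm

open Filter Topology in
theorem exists_eLpNorm_le_eLpNorm_add_eLpNorm_fderiv {E F : Type*} [NormedAddCommGroup E]
    [InnerProductSpace ℝ E] [FiniteDimensional ℝ E] [MeasurableSpace E] [BorelSpace E]
    (μ : Measure E) [μ.IsAddHaarMeasure]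
    [NormedAddCommGroup F] [NormedSpace ℝ F] [FiniteDimensional ℝ F] {p p' : ℝ≥0}
    (hp : 1 ≤ p) (hn : 0 < Module.finrank ℝ E)
    (hp' : (p' : ℝ)⁻¹ = (p : ℝ)⁻¹ - (Module.finrank ℝ E : ℝ)⁻¹) :
    ∃ C : ℝ≥0, ∀ u : E → F, ContDiff ℝ 1 u →
      eLpNorm u p' μ ≤ C * (eLpNorm u p μ + eLpNorm (fderiv ℝ u) p μ) := by
  let χ : ContDiffBump (0 : E) := ⟨1, 2, one_pos, one_lt_two⟩
  have hχ : ContDiff ℝ 1 χ := χ.contDiff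
  obtain ⟨M, hM⟩ := (hχ.continuous_fderiv one_ne_zero).bounded_above_of_compact_support
    (χ.hasCompactSupport.fderiv ℝ)
  have hM0 : 0 ≤ M := (norm_nonneg _).trans (hM 0)
  set S := SNormLESNormFDerivOfEqConst F μ p
  refine ⟨S * (1 + M.toNNReal), fun u hu => ?_⟩
  let c : ℕ → ℝ := fun n => ((n : ℝ) + 1)⁻¹
  have hc0 : ∀ n, 0 < c n := fun n => by positivity
  have hc1 : ∀ n, c n ≤ 1 := fun n => inv_le_one_of_one_le₀ (by simp)
  let U : ℕ → E → F := fun n x => χ (c n • x) • u x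
  have hχn : ∀ n, ContDiff ℝ 1 fun x => χ (c n • x) := fun n =>
    hχ.comp (contDiff_const_smul (c n))
  have hU : ∀ n, ContDiff ℝ 1 (U n) := fun n => (hχn n).smul hu
  have hUc : ∀ n, HasCompactSupport (U n) := fun n =>
    (χ.hasCompactSupport.comp_smul (hc0 n).ne').smul_right
  have hDU : ∀ n x, ‖fderiv ℝ (U n) x‖ ≤ ‖fderiv ℝ u x‖ + M * ‖u x‖ := by
    intro n x
    have h1 : fderiv ℝ (U n) x = χ (c n • x) • fderiv ℝ u x
        + (fderiv ℝ (fun x => χ (c n • x)) x).smulRight (u x) :=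
      fderiv_fun_smul ((hχn n).differentiable one_ne_zero x) (hu.differentiable one_ne_zero x)
    rw [h1, fderiv_comp_smul]
    refine (norm_add_le _ _).trans (add_le_add ?_ ?_)
    · rw [norm_smul, Real.norm_of_nonneg χ.nonneg]
      exact mul_le_of_le_one_left (norm_nonneg _) χ.le_one
    · rw [ContinuousLinearMap.norm_smulRight_apply, norm_smul, Real.norm_of_nonneg (hc0 n).le]
      gcongr
      exact (mul_le_of_le_one_left (norm_nonneg _) (hc1 n)).trans (hM _)
  have hbound : ∀ n, eLpNorm (U n) p' μ ≤
      (S * (1 + M.toNNReal) : ℝ≥0) * (eLpNorm u p μ + eLpNorm (fderiv ℝ u) p μ) := by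
    intro n
    have hDu : AEStronglyMeasurable (fderiv ℝ u) μ :=
      (hu.continuous_fderiv one_ne_zero).aestronglyMeasurable
    calc eLpNorm (U n) p' μ ≤ S * eLpNorm (fderiv ℝ (U n)) p μ :=
          eLpNorm_le_eLpNorm_fderiv_of_eq μ (hU n) (hUc n) hp hn hp'
      _ ≤ S * eLpNorm ((fun x => ‖fderiv ℝ u x‖) + M • fun x => ‖u x‖) p μ := by
          gcongr
          exact eLpNorm_mono_real (hDU n)
      _ ≤ S * (eLpNorm (fderiv ℝ u) p μ + M.toNNReal * eLpNorm u p μ) := by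
          gcongr
          refine (eLpNorm_add_le hDu.norm
            (hu.continuous.norm.aestronglyMeasurable.const_smul M) (by exact_mod_cast hp)).trans ?_
          rw [eLpNorm_norm, eLpNorm_const_smul, eLpNorm_norm]
          gcongr
          rw [Real.enorm_of_nonneg hM0]; rfl
      _ ≤ S * ((1 + M.toNNReal) * eLpNorm (fderiv ℝ u) p μ
            + (1 + M.toNNReal) * eLpNorm u p μ) := by
          gcongr
          · exact le_mul_of_one_le_left' (by simp)
          · simp
      _ = _ := by push_cast; ring
  refine (Lp.eLpNorm_lim_le_liminf_eLpNorm
    (fun n => (hU n).continuous.aestronglyMeasurable) u (ae_of_all _ fun x => ?_)).trans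
    ((liminf_le_liminf (Eventually.of_forall hbound)).trans (by simp))
  have hlim : Tendsto (fun n => c n • x) atTop (𝓝 0) := by
    simpa [c] using (tendsto_one_div_add_atTop_nhds_zero_nat (𝕜 := ℝ)).smul_const x
  refine tendsto_const_nhds.congr' ?_
  filter_upwards [hlim (Metric.closedBall_mem_nhds 0 one_pos)] with n hn
  simp [U, χ.one_of_mem_closedBall hn]

theorem deriv_deriv_nonneg_of_isLocalMin {g : ℝ → ℝ} {t : ℝ} (hg : ContinuousAt g t)
    (h : IsLocalMin g t) : 0 ≤ deriv (deriv g) t := by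
  by_contra! hneg
  have hmax := isLocalMax_of_deriv_deriv_neg hneg h.deriv_eq_zero hg
  have hconst : g =ᶠ[nhds t] fun _ => g t := by
    filter_upwards [h, hmax] with s h1 h2 using le_antisymm h2 h1
  have : deriv (deriv g) t = 0 := by
    rw [hconst.deriv.deriv_eq]; simp
  exact hneg.ne this

section
variable (N : ℕ)
local notation "𝔼" => EuclideanSpace ℝ (Fin N)

open SchwartzMap LineDeriv Filter

theorem exists_eLpNorm_le_H1 (hN : 3 ≤ N) (F : Type*) [NormedAddCommGroup F] [NormedSpace ℝ F]
    [FiniteDimensional ℝ F] :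
    ∃ C : ℝ≥0, ∀ u : 𝔼 → F, ContDiff ℝ 1 u → ∀ k : ℝ, 2 ≤ k → k ≤ 2 * N / ((N : ℝ) - 2) →
      eLpNorm u (ENNReal.ofReal k) volume ≤
        C * (eLpNorm u 2 volume + eLpNorm (fderiv ℝ u) 2 volume) := by
  have hN' : (3 : ℝ) ≤ N := by exact_mod_cast hN
  have hN2 : (0 : ℝ) < (N : ℝ) - 2 := by linarith
  have hq : 0 ≤ 2 * N / ((N : ℝ) - 2) := by positivity
  obtain ⟨C, hC⟩ := exists_eLpNorm_le_eLpNorm_add_eLpNorm_fderiv (E := 𝔼) (F := F) volume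
    (p := 2) (p' := (2 * N / ((N : ℝ) - 2)).toNNReal) (by norm_num) (by simp; omega) (by
      rw [Real.coe_toNNReal _ hq]
      simp only [finrank_euclideanSpace, Fintype.card_fin, NNReal.coe_ofNat]
      field_simp)
  refine ⟨C + 1, fun u hu k hk1 hk2 => eLpNorm_le_of_le_of_le
    hu.continuous.aestronglyMeasurable two_pos hk1 hk2 ?_ ?_⟩
  · rw [ENNReal.ofReal_ofNat]
    exact le_mul_of_one_le_of_le (by simp) le_self_add
  · refine (hC u hu).trans ?_
    push_cast
    gcongr
    exact le_self_add

variable {N}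

theorem lap_eq_sum_lineDeriv (w : 𝓢(𝔼, ℝ)) (x : 𝔼) :
    lap N (fun y => w y) x =
      ∑ i, fderiv ℝ (∂_{basisVec N i} w : 𝓢(𝔼, ℝ)) x (basisVec N i) := rfl

theorem lap_nonneg_of_isMin (w : 𝓢(𝔼, ℝ)) {x : 𝔼} (hx : ∀ y, w x ≤ w y) :
    0 ≤ lap N (fun y => w y) x := by
  rw [lap_eq_sum_lineDeriv]
  refine Finset.sum_nonneg fun i _ => ?_
  set e := basisVec N i
  have hline : ∀ t : ℝ, HasDerivAt (fun t : ℝ => x + t • e) e t := fun t => by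
    simpa using ((hasDerivAt_id t).smul_const e).const_add x
  have hcomp : ∀ (h : 𝓢(𝔼, ℝ)) (t : ℝ),
      HasDerivAt (fun t : ℝ => h (x + t • e)) (fderiv ℝ h (x + t • e) e) t := fun h t =>
    (h.hasFDerivAt _).comp_hasDerivAt t (hline t)
  have hmin : IsLocalMin (fun t : ℝ => w (x + t • e)) 0 :=
    Eventually.of_forall fun t => by simpa using hx _
  have h2 := deriv_deriv_nonneg_of_isLocalMin (hcomp w 0).continuousAt hmin
  have h1 : deriv (fun t : ℝ => w (x + t • e)) =
      fun t : ℝ => (∂_{e} w : 𝓢(𝔼, ℝ)) (x + t • e) := funext fun t => (hcomp w t).deriv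
  rw [h1, (hcomp _ 0).deriv] at h2
  simpa using h2

theorem nonneg_of_sub_lap_nonneg {α : ℝ} (w : 𝓢(𝔼, ℝ))
    (h : ∀ x, 0 ≤ w x - α ^ 2 * lap N (fun y => w y) x) (x : 𝔼) : 0 ≤ w x := by
  by_contra! hneg
  obtain ⟨x₀, hx₀⟩ := w.continuous.exists_forall_le' x
    ((w.tendsto_cocompact.eventually (lt_mem_nhds hneg)).mono fun _ => le_of_lt)
  have := mul_nonneg (sq_nonneg α) (lap_nonneg_of_isMin w hx₀)
  linarith [h x₀, hx₀ x]

theorem SchwartzMap.integrable_rpow_mul {w : 𝓢(𝔼, ℝ)} (hw : ∀ x, 0 ≤ w x) {a : ℝ} (ha : 0 ≤ a)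
    {g : 𝔼 → ℝ} (hg : Integrable g) : Integrable fun x => w x ^ a * g x := by
  obtain ⟨M, -, hM⟩ := w.decay 0 0
  refine hg.bdd_mul (c := M ^ a) (w.continuous.rpow_const fun _ => Or.inr ha).aestronglyMeasurable
    (ae_of_all _ fun x => ?_)
  rw [Real.norm_of_nonneg (Real.rpow_nonneg (hw x) a)]
  exact Real.rpow_le_rpow (hw x) ((le_norm_self _).trans (by simpa using hM x)) ha

theorem SchwartzMap.integrable_mul (f g : 𝓢(𝔼, ℝ)) : Integrable fun x => f x * g x := by
  obtain ⟨M, -, hM⟩ := f.decay 0 0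
  exact g.integrable.bdd_mul (c := M) f.continuous.aestronglyMeasurable
    (ae_of_all _ fun x => by simpa using hM x)

theorem integral_rpow_mul_fderiv_lineDeriv {w : 𝓢(𝔼, ℝ)} (hw : ∀ x, 0 ≤ w x) {p : ℝ} (hp : 2 ≤ p)
    (e : 𝔼) :
    ∫ x, w x ^ (p - 1) * fderiv ℝ (∂_{e} w : 𝓢(𝔼, ℝ)) x e =
      -∫ x, (p - 1) * (w x ^ (p - 2) * (fderiv ℝ w x e) ^ 2) := by
  have hD : ∀ x, HasFDerivAt (fun x => w x ^ (p - 1))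
      (((p - 1) * w x ^ (p - 1 - 1)) • fderiv ℝ w x) x := fun x =>
    (w.hasFDerivAt x).rpow_const (Or.inr (by linarith))
  have heq : ∀ x, fderiv ℝ (fun x => w x ^ (p - 1)) x e * (∂_{e} w : 𝓢(𝔼, ℝ)) x =
      (p - 1) * (w x ^ (p - 2) * (fderiv ℝ w x e) ^ 2) := fun x => by
    rw [(hD x).fderiv, lineDerivOp_apply_eq_fderiv, show p - 1 - 1 = p - 2 by ring]
    simp only [_root_.smul_apply, smul_eq_mul]
    ring
  have hsq : Integrable fun x => w x ^ (p - 2) * (fderiv ℝ w x e) ^ 2 :=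
    integrable_rpow_mul hw (by linarith) <| by
      simpa only [lineDerivOp_apply_eq_fderiv, ← sq] using integrable_mul (∂_{e} w) (∂_{e} w)
  rw [integral_mul_fderiv_eq_neg_fderiv_mul_of_integrable]
  · simp_rw [heq]
  · simpa only [heq] using hsq.const_mul (p - 1)
  · exact integrable_rpow_mul hw (by linarith) (∂_{e} (∂_{e} w)).integrable
  · exact integrable_rpow_mul hw (by linarith) (∂_{e} w).integrable
  · exact fun x _ => (hD x).differentiableAt
  · exact fun x _ => (∂_{e} w).differentiableAt

/-- Energy identity for `w - α²Δw` tested against `w ^ (p - 1)`. -/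
theorem integral_sub_lap_mul_rpow {w : 𝓢(𝔼, ℝ)} (hw : ∀ x, 0 ≤ w x) {p : ℝ} (hp : 2 ≤ p) (α : ℝ) :
    Integrable (fun x => (w x - α ^ 2 * lap N (fun y => w y) x) * w x ^ (p - 1)) ∧
    Integrable (fun x => w x ^ p) ∧
    Integrable (fun x => w x ^ (p - 2) * ‖fderiv ℝ w x‖ ^ 2) ∧
    ∫ x, (w x - α ^ 2 * lap N (fun y => w y) x) * w x ^ (p - 1) =
      (∫ x, w x ^ p) + α ^ 2 * (p - 1) * ∫ x, w x ^ (p - 2) * ‖fderiv ℝ w x‖ ^ 2 := by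
  have hnorm : ∀ x, w x ^ (p - 2) * ‖fderiv ℝ w x‖ ^ 2 =
      ∑ i, w x ^ (p - 2) * (fderiv ℝ w x (basisVec N i)) ^ 2 := fun x => by
    rw [← Finset.mul_sum]
    congr 1
    simpa [basisVec] using (EuclideanSpace.basisFun (Fin N) ℝ).norm_dual (fderiv ℝ w x)
  have hpow : ∀ x, w x ^ (p - 1) * w x = w x ^ p := fun x => by
    rw [← Real.rpow_add_one' (hw x) (by linarith)]; congr 1; ring
  have hI1 : Integrable (fun x => w x ^ p) := by
    simpa only [hpow] using integrable_rpow_mul hw (a := p - 1) (by linarith) w.integrable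
  have hI2 : ∀ i, Integrable fun x => w x ^ (p - 2) * (fderiv ℝ w x (basisVec N i)) ^ 2 :=
    fun i => integrable_rpow_mul hw (by linarith) <| by
      simpa only [lineDerivOp_apply_eq_fderiv, ← sq] using
        integrable_mul (∂_{basisVec N i} w) (∂_{basisVec N i} w)
  have hI3 : ∀ i, Integrable fun x =>
      w x ^ (p - 1) * fderiv ℝ (∂_{basisVec N i} w : 𝓢(𝔼, ℝ)) x (basisVec N i) := fun i =>
    integrable_rpow_mul hw (by linarith) (∂_{basisVec N i} (∂_{basisVec N i} w)).integrable
  have hsplit : ∀ x, (w x - α ^ 2 * lap N (fun y => w y) x) * w x ^ (p - 1) = w x ^ p -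
      α ^ 2 * ∑ i, w x ^ (p - 1) *
        fderiv ℝ (∂_{basisVec N i} w : 𝓢(𝔼, ℝ)) x (basisVec N i) := fun x => by
    rw [lap_eq_sum_lineDeriv, ← Finset.mul_sum, ← hpow]; ring
  have hI4 := (integrable_finsetSum Finset.univ fun i _ => hI3 i).const_mul (α ^ 2)
  simp_rw [hsplit, hnorm]
  refine ⟨hI1.sub hI4, hI1, integrable_finsetSum _ fun i _ => hI2 i, ?_⟩
  rw [integral_sub hI1 hI4, integral_const_mul, integral_finsetSum _ fun i _ => hI3 i,
    integral_finsetSum _ fun i _ => hI2 i]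
  simp_rw [integral_rpow_mul_fderiv_lineDeriv hw hp, integral_const_mul, Finset.sum_neg_distrib,
    ← Finset.mul_sum]
  ring


theorem ENNReal.HolderTriple.ofReal {a b c : ℝ} (ha : 0 < a) (hb : 0 < b) (hc : 0 < c)
    (h : a⁻¹ + b⁻¹ = c⁻¹) :
    ENNReal.HolderTriple (ENNReal.ofReal a) (ENNReal.ofReal b) (ENNReal.ofReal c) where
  inv_add_inv_eq_inv := by
    rw [← ENNReal.ofReal_inv_of_pos ha, ← ENNReal.ofReal_inv_of_pos hb,
      ← ENNReal.ofReal_inv_of_pos hc, ← ENNReal.ofReal_add (by positivity) (by positivity), h]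

theorem eLpNorm_two_le_of_integral_sq_le {F : Type*} [NormedAddCommGroup F] {g : 𝔼 → F} {B : ℝ}
    (hg : Integrable fun x => ‖g x‖ ^ 2) (h : ∫ x, ‖g x‖ ^ 2 ≤ B) :
    eLpNorm g 2 volume ≤ ENNReal.ofReal B ^ (1 / 2 : ℝ) := by
  rw [eLpNorm_eq_lintegral_rpow_enorm_toReal two_ne_zero ENNReal.ofNat_ne_top]
  simp only [ENNReal.toReal_ofNat, ENNReal.rpow_ofNat]
  gcongr
  refine le_trans (le_of_eq ?_) (ENNReal.ofReal_le_ofReal h)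
  rw [ofReal_integral_eq_lintegral_ofReal hg (ae_of_all _ fun x => sq_nonneg _)]
  exact lintegral_congr fun x => by
    rw [ENNReal.ofReal_pow (norm_nonneg _), ofReal_norm]

/-- Elliptic `L^s → L^m` smoothing for nonnegative solutions of `w - α²Δw = f`. -/
theorem exists_eLpNorm_le_of_sub_lap (hN : 3 ≤ N) {α : ℝ} (hα : 0 < α) {p m s : ℝ} (hp : 2 ≤ p)
    (hpm : p ≤ m) (hmp : m ≤ p * (N / ((N : ℝ) - 2))) (hs : 0 < s)
    (hms : (p - 1) / m + s⁻¹ = 1) :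
    ∃ C : ℝ≥0, ∀ (w : 𝓢(𝔼, ℝ)) (f : 𝔼 → ℝ), Continuous f → (∀ x, 0 ≤ w x) →
      (∀ x, w x - α ^ 2 * lap N (fun y => w y) x = f x) →
      eLpNorm w (ENNReal.ofReal m) volume ≤ C * eLpNorm f (ENNReal.ofReal s) volume := by
  obtain ⟨S, hS⟩ := exists_eLpNorm_le_H1 N hN ℝ
  have hp0 : 0 < p := by linarith
  have hm0 : 0 < m := by linarith
  have hp1 : 0 < p - 1 := by linarith
  set K : ℝ := (p / 2) ^ 2 / (α ^ 2 * (p - 1)) with hK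
  have hK0 : 0 ≤ K := by positivity
  refine ⟨(S * 2) ^ 2 * (1 + K).toNNReal, fun w f hf hw heq => ?_⟩
  obtain ⟨hIJ, hI1, hI2, hJ⟩ := integral_sub_lap_mul_rpow hw hp α
  simp only [heq] at hIJ hJ
  set J := ∫ x, f x * w x ^ (p - 1)
  have hA : 0 ≤ ∫ x, w x ^ p := integral_nonneg fun x => Real.rpow_nonneg (hw x) p
  have hB : 0 ≤ ∫ x, w x ^ (p - 2) * ‖fderiv ℝ w x‖ ^ 2 :=
    integral_nonneg fun x => mul_nonneg (Real.rpow_nonneg (hw x) _) (sq_nonneg _)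
  have hJ0 : 0 ≤ J := by rw [hJ]; positivity
  let u : 𝔼 → ℝ := fun x => w x ^ (p / 2)
  have hu : ContDiff ℝ 1 u :=
    (contDiff_rpow_const_of_le (p := p / 2) (n := 1) (by push_cast; linarith)).comp (w.smooth 1)
  have hu2 : ∀ x, ‖u x‖ ^ 2 = w x ^ p := fun x => by
    rw [Real.norm_eq_abs, sq_abs, ← Real.rpow_natCast, ← Real.rpow_mul (hw x)]
    congr 1; push_cast; ring
  have hDu2 : ∀ x, ‖fderiv ℝ u x‖ ^ 2 = (p / 2) ^ 2 * (w x ^ (p - 2) * ‖fderiv ℝ w x‖ ^ 2) :=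
    fun x => by
      rw [((w.hasFDerivAt x).rpow_const (Or.inr (by linarith : 1 ≤ p / 2))).fderiv, norm_smul,
        mul_pow, Real.norm_eq_abs, sq_abs, mul_pow, ← Real.rpow_natCast (w x ^ (p / 2 - 1)),
        ← Real.rpow_mul (hw x), mul_assoc]
      congr 3; push_cast; ring
  have hb1 : eLpNorm u 2 volume ≤ ENNReal.ofReal ((1 + K) * J) ^ (1 / 2 : ℝ) := by
    refine eLpNorm_two_le_of_integral_sq_le (by simpa only [hu2] using hI1) ?_
    simp only [hu2]
    have : 0 ≤ α ^ 2 * (p - 1) * ∫ x, w x ^ (p - 2) * ‖fderiv ℝ w x‖ ^ 2 := by positivity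
    nlinarith [mul_nonneg hK0 hJ0]
  have hb2 : eLpNorm (fderiv ℝ u) 2 volume ≤ ENNReal.ofReal ((1 + K) * J) ^ (1 / 2 : ℝ) := by
    refine eLpNorm_two_le_of_integral_sq_le (by simpa only [hDu2] using hI2.const_mul _) ?_
    simp only [hDu2, integral_const_mul]
    have : (p / 2) ^ 2 * ∫ x, w x ^ (p - 2) * ‖fderiv ℝ w x‖ ^ 2 =
        K * (α ^ 2 * (p - 1) * ∫ x, w x ^ (p - 2) * ‖fderiv ℝ w x‖ ^ 2) := by
      rw [hK]; field_simp
    rw [this]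
    nlinarith [mul_nonneg hK0 hA]
  set W := eLpNorm w (ENNReal.ofReal m) volume
  have hnorm_rpow : ∀ a b : ℝ, 0 < a → 0 < b → b * a = m →
      eLpNorm (fun x => w x ^ a) (ENNReal.ofReal b) volume = W ^ a := fun a b ha hb hab => by
    have := eLpNorm_norm_rpow (p := ENNReal.ofReal b) (μ := volume) w ha
    simp only [Real.norm_of_nonneg (hw _)] at this
    rw [this, ← ENNReal.ofReal_mul hb.le, hab]
  have hWu : W ^ (p / 2) ≤ S * 2 * ENNReal.ofReal ((1 + K) * J) ^ (1 / 2 : ℝ) := by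
    rw [← hnorm_rpow (p / 2) (2 * m / p) (by positivity) (by positivity) (by field_simp)]
    refine (hS u hu _ ?_ ?_).trans ?_
    · rw [le_div_iff₀ hp0]; linarith
    · rw [div_le_iff₀ hp0]
      calc 2 * m ≤ 2 * (p * (N / ((N : ℝ) - 2))) := by linarith
        _ = _ := by ring
    · rw [mul_assoc, two_mul]
      gcongr
  have hWp : W ^ p ≤ ((S * 2) ^ 2 * (1 + K).toNNReal : ℝ≥0) * ENNReal.ofReal J := by
    calc W ^ p = (W ^ (p / 2)) ^ (2 : ℝ) := by rw [← ENNReal.rpow_mul]; congr 1; ring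
      _ ≤ (S * 2 * ENNReal.ofReal ((1 + K) * J) ^ (1 / 2 : ℝ)) ^ (2 : ℝ) := by gcongr
      _ = (S * 2) ^ 2 * ENNReal.ofReal ((1 + K) * J) := by
        rw [ENNReal.mul_rpow_of_nonneg _ _ zero_le_two, ← ENNReal.rpow_mul, ENNReal.rpow_two]
        norm_num
      _ = _ := by
        rw [ENNReal.ofReal_mul (by positivity), ← mul_assoc]
        push_cast
        rfl
  have hJF : ENNReal.ofReal J ≤ W ^ (p - 1) * eLpNorm f (ENNReal.ofReal s) volume := by
    have := ENNReal.HolderTriple.ofReal (a := m / (p - 1)) (b := s) (c := 1) (by positivity) hs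
      one_pos (by rw [inv_div, hms, inv_one])
    calc ENNReal.ofReal J ≤ ‖J‖ₑ := by rw [Real.enorm_of_nonneg hJ0]
      _ ≤ ∫⁻ x, ‖f x * w x ^ (p - 1)‖ₑ := enorm_integral_le_lintegral_enorm _
      _ = eLpNorm ((fun x => w x ^ (p - 1)) • f) (ENNReal.ofReal 1) volume := by
        rw [ENNReal.ofReal_one, eLpNorm_one_eq_lintegral_enorm]
        exact lintegral_congr fun x => by simp [mul_comm]
      _ ≤ eLpNorm (fun x => w x ^ (p - 1)) (ENNReal.ofReal (m / (p - 1))) volume *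
          eLpNorm f (ENNReal.ofReal s) volume :=
        eLpNorm_smul_le_mul_eLpNorm hf.aestronglyMeasurable
          (w.continuous.rpow_const fun _ => Or.inr hp1.le).aestronglyMeasurable
      _ = _ := by
        rw [hnorm_rpow (p - 1) (m / (p - 1)) hp1 (by positivity) (by field_simp)]
  rcases eq_or_ne W 0 with hW0 | hW0
  · rw [hW0]; exact zero_le
  have hWtop : W ≠ ⊤ := (w.eLpNorm_lt_top _ volume).ne
  have hpow : W ^ p = W ^ (p - 1) * W := by
    conv_rhs => rw [← ENNReal.rpow_one W, ← ENNReal.rpow_mul, one_mul,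
      ← ENNReal.rpow_add _ _ hW0 hWtop]
    congr 1; ring
  have hfin : W ^ (p - 1) * W ≤ W ^ (p - 1) *
      (((S * 2) ^ 2 * (1 + K).toNNReal : ℝ≥0) * eLpNorm f (ENNReal.ofReal s) volume) := by
    rw [← hpow, mul_left_comm]
    exact hWp.trans (by gcongr)
  exact (ENNReal.mul_le_mul_iff_right (by simp [hW0, hWtop])
    (ENNReal.rpow_ne_top_of_nonneg hp1.le hWtop)).1 hfin

theorem exists_eLpNorm_le_H1norm (hN : 3 ≤ N) :
    ∃ C : ℝ, 0 < C ∧ ∀ (v : 𝓢(𝔼, ℂ)) (k : ℝ), 2 ≤ k → k ≤ 2 * N / ((N : ℝ) - 2) →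
      eLpNorm v (ENNReal.ofReal k) volume ≤ ENNReal.ofReal (C * H1norm N (fun y => v y)) := by
  obtain ⟨S, hS⟩ := exists_eLpNorm_le_H1 N hN ℂ
  refine ⟨S * 2 + 1, by positivity, fun v k hk1 hk2 => (hS v (v.smooth 1) k hk1 hk2).trans ?_⟩
  have ha : eLpNorm v 2 volume = ENNReal.ofReal (LpN N v 2) := by
    rw [LpN, ENNReal.ofReal_ofNat]
    exact (ENNReal.ofReal_toReal (v.eLpNorm_lt_top 2 volume).ne).symm
  have hb : eLpNorm (fderiv ℝ v) 2 volume = ENNReal.ofReal (gradL2 N v) :=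
    (ENNReal.ofReal_toReal ((fderivCLM ℝ 𝔼 ℂ v).eLpNorm_lt_top 2 volume).ne).symm
  have ha0 : 0 ≤ LpN N v 2 := ENNReal.toReal_nonneg
  have hb0 : 0 ≤ gradL2 N v := ENNReal.toReal_nonneg
  rw [ha, hb, ← ENNReal.ofReal_add ha0 hb0, ← ENNReal.ofReal_coe_nnreal,
    ← ENNReal.ofReal_mul (by positivity)]
  refine ENNReal.ofReal_le_ofReal ?_
  have h1 : LpN N v 2 ≤ H1norm N v := Real.le_sqrt_of_sq_le (by linarith [sq_nonneg (gradL2 N v)])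
  have h2 : gradL2 N v ≤ H1norm N v := Real.le_sqrt_of_sq_le (by linarith [sq_nonneg (LpN N v 2)])
  have h3 : (S : ℝ) * (LpN N v 2 + gradL2 N v) ≤ S * (H1norm N v + H1norm N v) := by gcongr
  linarith

end

/-- (Lemma 3, case `N ≥ 3`) estimate for
`‖B(|v|^σ)|v|^{σ-1}v(v₁-v₂)‖_{r'} ≤ C_α ‖v‖_{H¹}^{2σ} ‖v₁-v₂‖_r`,
where `w = B(|v|^σ)` solves the Helmholtz equation `w - α²Δw = |v|^σ`. -/
theorem stmt2 (N : ℕ) (hN : 3 ≤ N) (α : ℝ) (hα : 0 < α) (σ : ℝ) (hσ : 1 ≤ σ)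
    (hσ' : σ < 4 / ((N : ℝ) - 2)) :
    ∃ r r' : ℝ, 2 < r ∧ r ≤ 2 * N / ((N : ℝ) - 2) ∧ 1 / r + 1 / r' = 1 ∧
      ∃ C : ℝ, 0 < C ∧
        ∀ (v : SchwartzMap (EuclideanSpace ℝ (Fin N)) ℂ)
          (w : SchwartzMap (EuclideanSpace ℝ (Fin N)) ℝ),
          (∀ x, w x - α ^ 2 * lap N (fun y => w y) x = ‖v x‖ ^ σ) →
          ∀ (v₁ v₂ : SchwartzMap (EuclideanSpace ℝ (Fin N)) ℂ),
            LpN N (fun x =>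
                (w x : ℂ) * ((‖v x‖ ^ (σ - 1) : ℝ) : ℂ) * v x * (v₁ x - v₂ x)) r'
              ≤ C * (H1norm N (fun y => v y)) ^ (2 * σ) *
                  LpN N (fun x => v₁ x - v₂ x) r := by
  have hN' : (3 : ℝ) ≤ N := by exact_mod_cast hN
  have hN2 : (0 : ℝ) < (N : ℝ) - 2 := by linarith
  have hx4 : σ * ((N : ℝ) - 2) < 4 := by rwa [lt_div_iff₀ hN2] at hσ'
  obtain ⟨y, hy2, hyx, hy4, hyN⟩ : ∃ y : ℝ, 2 ≤ y ∧ σ * ((N : ℝ) - 2) ≤ y ∧ y < 4 ∧ y ≤ σ * N :=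
    ⟨max (σ * ((N : ℝ) - 2)) 2, le_max_right _ _, le_max_left _ _, max_lt hx4 (by norm_num),
      max_le (by nlinarith) (by nlinarith)⟩
  have hy : 0 < 4 - y := by linarith
  set r : ℝ := 2 * N / ((N : ℝ) - 2) with hr
  set m : ℝ := 2 * N / (4 - y) with hm
  set t : ℝ := 2 * N / y with ht
  set p : ℝ := (2 * N + 4 - 2 * y) / (4 - y) with hp
  have hr0 : 0 < r := by positivity
  have hm0 : 0 < m := by positivity
  have ht0 : 0 < t := by positivity
  obtain ⟨C₁, hC₁⟩ := exists_eLpNorm_le_of_sub_lap hN hα (p := p) (m := m) (s := t)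
    (by rw [hp, le_div_iff₀ hy]; linarith)
    (by rw [hp, hm]; gcongr; linarith)
    (by
      rw [hp, hm, div_mul_div_comm, div_le_div_iff₀ hy (by positivity)]
      have : 0 ≤ N * (4 - y) * (4 - y) := by positivity
      nlinarith)
    ht0 (by rw [hp, hm, ht]; field_simp; ring)
  obtain ⟨C₂, hC₂0, hC₂⟩ := exists_eLpNorm_le_H1norm hN
  refine ⟨r, 2 * N / (N + 2), ?_, le_rfl, ?_, C₁ * C₂ ^ (2 * σ) + 1, by positivity, ?_⟩
  · rw [hr, lt_div_iff₀ hN2]; linarith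
  · rw [hr]; field_simp; ring
  intro v w hw v₁ v₂
  have hσ0 : 0 < σ := by linarith
  have hw0 : ∀ x, 0 ≤ w x := nonneg_of_sub_lap_nonneg w fun x => by rw [hw x]; positivity
  have hfc : Continuous fun x => ‖v x‖ ^ σ := v.continuous.norm.rpow_const fun _ => Or.inr hσ0.le
  set H := H1norm N (fun y => v y)
  have hH : 0 ≤ H := Real.sqrt_nonneg _
  have hf : eLpNorm (fun x => ‖v x‖ ^ σ) (ENNReal.ofReal t) volume ≤
      ENNReal.ofReal ((C₂ * H) ^ σ) := by
    rw [eLpNorm_norm_rpow _ hσ0, ← ENNReal.ofReal_mul ht0.le,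
      ← ENNReal.ofReal_rpow_of_nonneg (by positivity) hσ0.le]
    gcongr
    refine hC₂ v _ ?_ ?_
    · rw [ht, div_mul_eq_mul_div, le_div_iff₀ (by linarith)]; linarith
    · rw [ht, div_mul_eq_mul_div, div_le_div_iff₀ (by linarith) hN2]
      nlinarith
  have hwf : eLpNorm (fun x => w x) (ENNReal.ofReal m) volume ≤
      ENNReal.ofReal (C₁ * (C₂ * H) ^ σ) := by
    rw [ENNReal.ofReal_mul (by positivity), ENNReal.ofReal_coe_nnreal]
    exact (hC₁ w _ hfc hw0 hw).trans (by gcongr)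
  have hd : eLpNorm (fun x => v₁ x - v₂ x) (ENNReal.ofReal r) volume =
      ENNReal.ofReal (LpN N (fun x => v₁ x - v₂ x) r) :=
    (ENNReal.ofReal_toReal ((v₁ - v₂).eLpNorm_lt_top (ENNReal.ofReal r) volume).ne).symm
  have hL : 0 ≤ LpN N (fun x => v₁ x - v₂ x) r := ENNReal.toReal_nonneg
  have := ENNReal.HolderTriple.ofReal (a := m) (b := t) (c := N / 2) hm0 ht0 (by positivity)
    (by rw [hm, ht]; field_simp; ring)
  have := ENNReal.HolderTriple.ofReal (a := N / 2) (b := r) (c := 2 * N / (N + 2))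
    (by positivity) hr0 (by positivity) (by rw [hr]; field_simp; ring)
  refine ENNReal.toReal_le_of_le_ofReal (by positivity) ?_
  calc _ = eLpNorm (((fun x => w x) • fun x => ‖v x‖ ^ σ) • fun x => v₁ x - v₂ x)
        (ENNReal.ofReal (2 * N / (N + 2))) volume := by
        refine eLpNorm_congr_norm_ae (ae_of_all _ fun x => ?_)
        have hv : ‖v x‖ ^ (σ - 1) * ‖v x‖ = ‖v x‖ ^ σ := by
          rw [← Real.rpow_add_one' (norm_nonneg _) (by linarith), sub_add_cancel]
        change _ = ‖(w x * ‖v x‖ ^ σ) • (v₁ x - v₂ x)‖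
        rw [← hv, norm_smul]
        simp only [norm_mul, Complex.norm_real, norm_norm, mul_assoc]
    _ ≤ ENNReal.ofReal (C₁ * (C₂ * H) ^ σ) * ENNReal.ofReal ((C₂ * H) ^ σ) *
        ENNReal.ofReal (LpN N (fun x => v₁ x - v₂ x) r) := by
        rw [← hd]
        refine (eLpNorm_smul_le_mul_eLpNorm (p := ENNReal.ofReal (N / 2))
          (q := ENNReal.ofReal r) (v₁ - v₂).continuous.aestronglyMeasurable
          (w.continuous.smul hfc).aestronglyMeasurable).trans ?_
        refine mul_le_mul' ?_ le_rfl
        exact (eLpNorm_smul_le_mul_eLpNorm (p := ENNReal.ofReal m) (q := ENNReal.ofReal t)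
          hfc.aestronglyMeasurable w.continuous.aestronglyMeasurable).trans (by gcongr)
    _ = ENNReal.ofReal (C₁ * C₂ ^ (2 * σ) * H ^ (2 * σ) * LpN N (fun x => v₁ x - v₂ x) r) := by
        rw [← ENNReal.ofReal_mul (by positivity), ← ENNReal.ofReal_mul (by positivity)]
        congr 2
        rw [mul_assoc, ← sq, ← Real.rpow_mul_natCast (by positivity), mul_assoc,
          ← Real.mul_rpow hC₂0.le hH]
        congr 2
        push_cast; ring
    _ ≤ _ := by
        refine ENNReal.ofReal_le_ofReal ?_
        gcongr
        linarith
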